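/- Let λ, p, q, A ∈ ℝ with A ≠ 0, let B̃ ∈ ℝ, set κ = λ + (pq/A)·(1 − B̃), and assume κ ≠ 0 and |1 + Δt·κ| < 1 for a given Δt ∈ ℝ. Let X₀ ∈ ℝ and take the exact initialization F̄₀ = (λ + pq/A)·X₀. Then the limit of X̄(N) = X₀ + (((1 + Δt·κ)^N − 1)/κ)·F̄₀ as N → ∞ equals −((pq/A)·B̃·X₀)/κ. In particular, the limit equals 0 (no asymptotic bias with respect to the exact dynamics, whose solutions decay to 0) if and only if B̃·X₀·pq = 0. -/

import Mathlib

open Filter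

/-- Asymptotic bias of the variance-reduced trajectory with exact initialization
`F̄₀ = (λ + pq/A)·X₀`: with `κ = λ + (pq/A)(1 − B̃)` and `|1 + Δt·κ| < 1`, the trajectory
`X̄(N) = X₀ + (((1 + Δt·κ)^N − 1)/κ)·F̄₀` converges to `−((pq/A)·B̃·X₀)/κ`, and this limit
vanishes if and only if `B̃·X₀·pq = 0`. -/
theorem vr_trajectory_asymptotic_bias (lam p q A : ℝ) (hA : A ≠ 0) (Btil : ℝ) (Δt : ℝ)
    (hκ : lam + (p * q / A) * (1 - Btil) ≠ 0)
    (hstab : |1 + Δt * (lam + (p * q / A) * (1 - Btil))| < 1) (X₀ : ℝ) :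
    Tendsto (fun N : ℕ =>
        X₀ + (((1 + Δt * (lam + (p * q / A) * (1 - Btil))) ^ N - 1)
          / (lam + (p * q / A) * (1 - Btil))) * ((lam + p * q / A) * X₀))
      atTop (nhds (-((p * q / A) * Btil * X₀) / (lam + (p * q / A) * (1 - Btil)))) ∧
    (-((p * q / A) * Btil * X₀) / (lam + (p * q / A) * (1 - Btil)) = 0
      ↔ Btil * X₀ * (p * q) = 0) := by
  constructor
  · have h := tendsto_pow_atTop_nhds_zero_of_abs_lt_one hstab
    have h2 := (((h.sub_const 1).div_const (lam + (p * q / A) * (1 - Btil))).mul_const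
      ((lam + p * q / A) * X₀)).const_add X₀
    have e : -((p * q / A) * Btil * X₀) / (lam + (p * q / A) * (1 - Btil))
        = X₀ + (0 - 1) / (lam + (p * q / A) * (1 - Btil)) * ((lam + p * q / A) * X₀) := by
      generalize p * q / A = r at *
      rw [div_eq_iff hκ, add_mul, mul_right_comm (_ / _), div_mul_cancel₀ _ hκ]
      ring
    rw [e]
    exact h2
  · have e : Btil * X₀ * (p * q) = A * ((p * q / A) * Btil * X₀) := by
      field_simp
    rw [e, div_eq_zero_iff, neg_eq_zero, mul_eq_zero (a := A)]
    simp only [hκ, hA, or_false, false_or]
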